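/- For every integer k with 2 ≤ k and 2k ≤ n and every sign ε ∈ {1,−1}, the B-orbit { b·X_{k,ε}·b⁻¹ : b ∈ B } is an open subset of the orbit O_{k,ε} in its subspace topology. -/

import Mathlib

open Matrix

/-- The n×n real matrix unit `E_{a,b}` (1-based indices). -/
noncomputable def Ematrix (n a b : ℕ) : Matrix (Fin n) (Fin n) ℝ :=
  fun s t => if (s : ℕ) + 1 = a ∧ (t : ℕ) + 1 = b then 1 else 0

/-- `X_{k,ε} = Σ_{i=1}^{k−1} E_{n+1−i,i} + ε·E_{n+1−k,k}`. -/
noncomputable def Xmat (n k : ℕ) (ε : ℝ) : Matrix (Fin n) (Fin n) ℝ :=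
  (∑ i ∈ Finset.Icc 1 (k - 1), Ematrix n (n + 1 - i) i) + ε • Ematrix n (n + 1 - k) k

/-- The spherical nilpotent orbit `O_{k,ε} = { g·X_{k,ε}·g⁻¹ : g ∈ SL_n(ℝ) }`. -/
def Orb (n k : ℕ) (ε : ℝ) : Set (Matrix (Fin n) (Fin n) ℝ) :=
  {M | ∃ g : Matrix.SpecialLinearGroup (Fin n) ℝ, g.val * Xmat n k ε * (g⁻¹).val = M}

/-- The `B`-orbit `{ b·X_{k,ε}·b⁻¹ : b ∈ B }`, `B` the upper-triangular Borel subgroup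
of `SL_n(ℝ)`. -/
def BOrb (n k : ℕ) (ε : ℝ) : Set (Matrix (Fin n) (Fin n) ℝ) :=
  {M | ∃ b : Matrix.SpecialLinearGroup (Fin n) ℝ,
    (∀ s t : Fin n, (t : ℕ) < (s : ℕ) → b.val s t = 0) ∧
    b.val * Xmat n k ε * (b⁻¹).val = M}

/-- The coefficient of `X_{k,ε}` in the (0-based) column `i`. -/
noncomputable def antiCoeff (k : ℕ) (ε : ℝ) (i : ℕ) : ℝ :=
  if i + 1 < k then 1 else if i + 1 = k then ε else 0

lemma antiCoeff_eq_zero {k : ℕ} (ε : ℝ) {i : ℕ} (h : k ≤ i) : antiCoeff k ε i = 0 := by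
  unfold antiCoeff
  rw [if_neg (by omega), if_neg (by omega)]

lemma antiCoeff_mul_self {k : ℕ} {ε : ℝ} (hε : ε = 1 ∨ ε = -1) {i : ℕ} (h : i < k) :
    antiCoeff k ε i * antiCoeff k ε i = 1 := by
  unfold antiCoeff
  split_ifs
  · norm_num
  · rcases hε with rfl | rfl <;> norm_num
  · omega

lemma antiCoeff_ne_zero {k : ℕ} {ε : ℝ} (hε : ε = 1 ∨ ε = -1) {i : ℕ} (h : i < k) :
    antiCoeff k ε i ≠ 0 := by
  intro h0
  simpa [h0] using antiCoeff_mul_self hε h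

lemma Xmat_apply {n k : ℕ} (hk : 2 ≤ k) (hkn : 2 * k ≤ n) (ε : ℝ) (s t : Fin n) :
    Xmat n k ε s t = if s = t.rev then antiCoeff k ε t else 0 := by
  have hs := s.2
  have ht := t.2
  have hrev : s = t.rev ↔ (s : ℕ) + t + 1 = n := by
    rw [Fin.ext_iff, Fin.val_rev]
    omega
  simp only [Xmat, Matrix.add_apply, Matrix.sum_apply, Matrix.smul_apply, smul_eq_mul, Ematrix]
  rw [Finset.sum_eq_ite ((t : ℕ) + 1)]
  · simp only [hrev, antiCoeff, Finset.mem_Icc]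
    split_ifs <;> first | omega | (simp; done) | (exfalso; simp only [and_true] at *; omega)
  · intro i _ hi
    exact if_neg fun h => hi h.2.symm

lemma mul_Xmat_apply {n k : ℕ} (hk : 2 ≤ k) (hkn : 2 * k ≤ n) (ε : ℝ)
    (A : Matrix (Fin n) (Fin n) ℝ) (s t : Fin n) :
    (A * Xmat n k ε) s t = A s t.rev * antiCoeff k ε t := by
  simp [Matrix.mul_apply, Xmat_apply hk hkn]

lemma Xmat_mul_apply {n k : ℕ} (hk : 2 ≤ k) (hkn : 2 * k ≤ n) (ε : ℝ)
    (A : Matrix (Fin n) (Fin n) ℝ) (s t : Fin n) :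
    (Xmat n k ε * A) s t = antiCoeff k ε s.rev * A s.rev t := by
  rw [Matrix.mul_apply, Finset.sum_eq_single s.rev]
  · simp [Xmat_apply hk hkn]
  · intro j _ hj
    rw [Xmat_apply hk hkn, if_neg, zero_mul]
    rintro rfl
    simp at hj
  · simp

lemma Xmat_mulVec_apply {n k : ℕ} (hk : 2 ≤ k) (hkn : 2 * k ≤ n) (ε : ℝ)
    (v : Fin n → ℝ) (s : Fin n) :
    (Xmat n k ε *ᵥ v) s = antiCoeff k ε s.rev * v s.rev := by
  have h := Xmat_mul_apply hk hkn ε (Matrix.of fun i _ => v i) s s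
  rwa [Matrix.mul_apply] at h

lemma Xmat_mul_self {n k : ℕ} (hk : 2 ≤ k) (hkn : 2 * k ≤ n) (ε : ℝ) :
    Xmat n k ε * Xmat n k ε = 0 := by
  ext s t
  rw [mul_Xmat_apply hk hkn, Xmat_apply hk hkn, Fin.rev_rev, Matrix.zero_apply]
  have ht := t.2
  rcases le_or_gt k (t : ℕ) with h | h
  · simp [antiCoeff_eq_zero ε h]
  · have : k ≤ (t.rev : ℕ) := by rw [Fin.val_rev]; omega
    rw [antiCoeff_eq_zero ε this, ite_self, zero_mul]

/-- The lower-left `i × i` corner of `M` with rows reversed, extended by the identity. -/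
def corner {n : ℕ} (i : ℕ) (M : Matrix (Fin n) (Fin n) ℝ) : Matrix (Fin n) (Fin n) ℝ :=
  fun s t => if (s : ℕ) < i ∧ (t : ℕ) < i then M s.rev t else if s = t then 1 else 0

lemma continuous_corner {n : ℕ} (i : ℕ) :
    Continuous (corner i : Matrix (Fin n) (Fin n) ℝ → Matrix (Fin n) (Fin n) ℝ) := by
  refine continuous_matrix fun s t => ?_
  unfold corner
  split_ifs
  · exact continuous_id.matrix_elem _ _
  all_goals exact continuous_const

lemma corner_mulVec_of_lt {n : ℕ} {i : ℕ} (M : Matrix (Fin n) (Fin n) ℝ) (v : Fin n → ℝ)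
    {s : Fin n} (hs : (s : ℕ) < i) :
    (corner i M *ᵥ v) s = (M *ᵥ fun t => if (t : ℕ) < i then v t else 0) s.rev := by
  simp only [Matrix.mulVec, dotProduct, corner]
  refine Finset.sum_congr rfl fun t _ => ?_
  by_cases ht : (t : ℕ) < i
  · simp [hs, ht]
  · have : s ≠ t := by rintro rfl; exact ht hs
    simp [ht, this]

lemma corner_mulVec_of_le {n : ℕ} {i : ℕ} (M : Matrix (Fin n) (Fin n) ℝ) (v : Fin n → ℝ)
    {s : Fin n} (hs : i ≤ (s : ℕ)) : (corner i M *ᵥ v) s = v s := by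
  simp [Matrix.mulVec, dotProduct, corner, not_lt.mpr hs]

lemma truncate_eq_self {n i : ℕ} {v : Fin n → ℝ} (hv : ∀ s : Fin n, i ≤ (s : ℕ) → v s = 0) :
    (fun t : Fin n => if (t : ℕ) < i then v t else 0) = v := by
  ext t
  split_ifs with h
  · rfl
  · exact (hv t (not_lt.mp h)).symm

lemma corner_det_ne_zero_iff {n i : ℕ} {M : Matrix (Fin n) (Fin n) ℝ} :
    (corner i M).det ≠ 0 ↔ ∀ v : Fin n → ℝ, (∀ s : Fin n, i ≤ (s : ℕ) → v s = 0) →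
      (∀ s : Fin n, (s : ℕ) < i → (M *ᵥ v) s.rev = 0) → v = 0 := by
  rw [Ne, ← Matrix.exists_mulVec_eq_zero_iff]
  constructor
  · intro h v hv hM
    by_contra hne
    refine h ⟨v, hne, funext fun s => ?_⟩
    rcases lt_or_ge (s : ℕ) i with hs | hs
    · rw [corner_mulVec_of_lt M v hs, truncate_eq_self hv]
      exact hM s hs
    · rw [corner_mulVec_of_le M v hs]
      exact hv s hs
  · rintro h ⟨v, hne, h0⟩
    have hv : ∀ s : Fin n, i ≤ (s : ℕ) → v s = 0 := fun s hs => by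
      rw [← corner_mulVec_of_le M v hs, h0, Pi.zero_apply]
    refine hne (h v hv fun s hs => ?_)
    have := corner_mulVec_of_lt M v hs
    rw [truncate_eq_self hv, h0] at this
    exact this.symm

lemma exists_corner_solution {n i : ℕ} {M : Matrix (Fin n) (Fin n) ℝ}
    (h : (corner i M).det ≠ 0) (w : Fin n → ℝ) :
    ∃ v : Fin n → ℝ, (∀ s : Fin n, i ≤ (s : ℕ) → v s = 0) ∧
      ∀ s : Fin n, (s : ℕ) < i → (M *ᵥ v) s.rev = w s := by
  obtain ⟨v, hv⟩ := (Matrix.mulVec_surjective_iff_isUnit.mpr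
    ((Matrix.isUnit_iff_isUnit_det _).mpr h.isUnit)) fun s => if (s : ℕ) < i then w s else 0
  have hsupp : ∀ s : Fin n, i ≤ (s : ℕ) → v s = 0 := fun s hs => by
    rw [← corner_mulVec_of_le M v hs, hv]
    exact if_neg (not_lt.mpr hs)
  refine ⟨v, hsupp, fun s hs => ?_⟩
  have := corner_mulVec_of_lt M v hs
  rw [truncate_eq_self hsupp, hv] at this
  exact this.symm.trans (if_pos hs)

lemma upperTriangular_mulVec_support {n m : ℕ} {A : Matrix (Fin n) (Fin n) ℝ}
    (hA : A.BlockTriangular id) {v : Fin n → ℝ} (hv : ∀ s : Fin n, m ≤ (s : ℕ) → v s = 0)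
    (s : Fin n) (hs : m ≤ (s : ℕ)) : (A *ᵥ v) s = 0 := by
  rw [Matrix.mulVec, dotProduct]
  refine Finset.sum_eq_zero fun t _ => ?_
  rcases lt_or_ge t s with h | h
  · rw [hA h, zero_mul]
  · rw [hv t (hs.trans h), mul_zero]

lemma corner_det_ne_zero_of_upperTriangular {n k : ℕ} (hk : 2 ≤ k) (hkn : 2 * k ≤ n) {ε : ℝ}
    (hε : ε = 1 ∨ ε = -1) {b : Matrix (Fin n) (Fin n) ℝ} (hb : b.BlockTriangular id)
    (hdet : IsUnit b.det) {i : ℕ} (hi : i ≤ k) :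
    (corner i (b * Xmat n k ε * b⁻¹)).det ≠ 0 := by
  have : Invertible b := b.invertibleOfIsUnitDet hdet
  have hbinv : b⁻¹.BlockTriangular id := Matrix.blockTriangular_inv_of_blockTriangular hb
  refine corner_det_ne_zero_iff.mpr fun v hv hM => ?_
  set u := b⁻¹ *ᵥ v with hu
  have hv' : v = b *ᵥ u := by
    rw [hu, Matrix.mulVec_mulVec, Matrix.mul_nonsing_inv _ hdet, Matrix.one_mulVec]
  have hus : ∀ s : Fin n, i ≤ (s : ℕ) → u s = 0 := upperTriangular_mulVec_support hbinv hv
  have hX : Xmat n k ε *ᵥ u = b⁻¹ *ᵥ ((b * Xmat n k ε * b⁻¹) *ᵥ v) := by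
    rw [hu, Matrix.mulVec_mulVec, Matrix.mulVec_mulVec, Matrix.mul_assoc b,
      Matrix.nonsing_inv_mul_cancel_left _ _ hdet]
  have hu0 : u = 0 := by
    ext s
    rcases lt_or_ge (s : ℕ) i with hs | hs
    · have h0 : (Xmat n k ε *ᵥ u) s.rev = 0 := by
        rw [hX]
        refine upperTriangular_mulVec_support (m := n - i) hbinv (fun t ht => ?_) _ ?_
        · have := hM t.rev (by rw [Fin.val_rev]; omega)
          rwa [Fin.rev_rev] at this
        · rw [Fin.val_rev]; omega
      rw [Xmat_mulVec_apply hk hkn, Fin.rev_rev] at h0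
      exact (mul_eq_zero.mp h0).resolve_left (antiCoeff_ne_zero hε (hs.trans_le hi))
    · exact hus s hs
  rw [hv', hu0, Matrix.mulVec_zero]

/-- If the corner of a conjugate `M` of `X_{k,ε}` is nondegenerate, then `M v` is determined by its
last `k` coordinates. -/
lemma conj_mulVec_eq_zero {n k : ℕ} (hk : 2 ≤ k) (hkn : 2 * k ≤ n) {ε : ℝ}
    {g : Matrix (Fin n) (Fin n) ℝ}
    (h : (corner k (g * Xmat n k ε * g⁻¹)).det ≠ 0) {u : Fin n → ℝ}
    (hu : ∀ s : Fin n, (s : ℕ) < k → ((g * Xmat n k ε * g⁻¹) *ᵥ u) s.rev = 0) :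
    (g * Xmat n k ε * g⁻¹) *ᵥ u = 0 := by
  have htrunc : ∀ x : Fin n → ℝ,
      (g * Xmat n k ε) *ᵥ (fun t => if (t : ℕ) < k then x t else 0) =
        (g * Xmat n k ε) *ᵥ x := by
    intro x
    rw [← Matrix.mulVec_mulVec, ← Matrix.mulVec_mulVec]
    congr 1
    ext s
    rw [Xmat_mulVec_apply hk hkn, Xmat_mulVec_apply hk hkn]
    split_ifs with hs
    · rfl
    · rw [antiCoeff_eq_zero ε (not_lt.mp hs), zero_mul, zero_mul]
  have hsurj : Function.Surjective (corner k (g * Xmat n k ε)).mulVec := by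
    intro w
    obtain ⟨v, -, hv⟩ := exists_corner_solution h w
    refine ⟨fun t => if (t : ℕ) < k then (g⁻¹ *ᵥ v) t else w t, funext fun s => ?_⟩
    rcases lt_or_ge (s : ℕ) k with hs | hs
    · rw [corner_mulVec_of_lt _ _ hs, ← hv s hs, ← Matrix.mulVec_mulVec v _ g⁻¹,
        ← htrunc (g⁻¹ *ᵥ v)]
      congr 2
      ext t
      by_cases ht : (t : ℕ) < k <;> simp [ht]
    · rw [corner_mulVec_of_le _ _ hs, if_neg (not_lt.mpr hs)]
  have hinj := Matrix.mulVec_injective_iff_isUnit.mpr (Matrix.mulVec_surjective_iff_isUnit.mp hsurj)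
  have h0 : (fun t : Fin n => if (t : ℕ) < k then (g⁻¹ *ᵥ u) t else 0) = 0 := by
    apply hinj
    rw [Matrix.mulVec_zero]
    ext s
    rcases lt_or_ge (s : ℕ) k with hs | hs
    · have := hu s hs
      rw [← Matrix.mulVec_mulVec, ← htrunc] at this
      rw [corner_mulVec_of_lt _ _ hs, htrunc]
      exact this
    · rw [corner_mulVec_of_le _ _ hs, if_neg (not_lt.mpr hs), Pi.zero_apply]
  rw [← Matrix.mulVec_mulVec, ← htrunc, h0, Matrix.mulVec_zero]

lemma exists_adapted_vector {n k : ℕ} {M : Matrix (Fin n) (Fin n) ℝ}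
    (hcorner : ∀ i ≤ k, (corner i M).det ≠ 0)
    (hker : ∀ u : Fin n → ℝ, (∀ s : Fin n, (s : ℕ) < k → (M *ᵥ u) s.rev = 0) → M *ᵥ u = 0)
    (t : Fin n) :
    ∃ v : Fin n → ℝ, (∀ s, t < s → v s = 0) ∧ v t ≠ 0 ∧
      ((t : ℕ) < k → ∀ s ≤ t, (M *ᵥ v) s.rev = if s = t then 1 else 0) ∧
      (k ≤ (t : ℕ) → M *ᵥ v = 0) := by
  rcases lt_or_ge (t : ℕ) k with ht | ht
  · obtain ⟨v, hv, hMv⟩ := exists_corner_solution (hcorner (t + 1) ht)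
      fun s => if s = t then 1 else 0
    refine ⟨v, fun s hs => hv s hs, fun h0 => ?_, fun _ s hs => hMv s (Nat.lt_succ_of_le hs),
      fun h => absurd ht (not_lt.mpr h)⟩
    have hv0 : v = 0 := by
      refine corner_det_ne_zero_iff.mp (hcorner t ht.le) v (fun s hs => ?_) fun s hs => ?_
      · rcases eq_or_lt_of_le (show t ≤ s from hs) with rfl | h
        · exact h0
        · exact hv s h
      · rw [hMv s (Nat.lt_succ_of_lt hs), if_neg (ne_of_lt (show s < t from hs))]
    simpa [hv0] using hMv t (Nat.lt_succ_self _)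
  · obtain ⟨w, hw, hMw⟩ := exists_corner_solution (hcorner k le_rfl)
      fun s => (M *ᵥ Pi.single t 1) s.rev
    refine ⟨Pi.single t 1 - w, fun s hs => ?_, ?_, fun h => absurd h (not_lt.mpr ht), fun _ => ?_⟩
    · simp [hw s (ht.trans (show (t : ℕ) ≤ s from hs.le)), hs.ne']
    · simp [hw t ht]
    · refine hker _ fun s hs => ?_
      rw [Matrix.mulVec_sub, Pi.sub_apply, hMw s hs, sub_self]

lemma exists_upperTriangular_intertwiner {n k : ℕ} (hk : 2 ≤ k) (hkn : 2 * k ≤ n) {ε : ℝ}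
    (hε : ε = 1 ∨ ε = -1) {M : Matrix (Fin n) (Fin n) ℝ} (hM : M * M = 0)
    (hcorner : ∀ i ≤ k, (corner i M).det ≠ 0)
    (hker : ∀ u : Fin n → ℝ, (∀ s : Fin n, (s : ℕ) < k → (M *ᵥ u) s.rev = 0) → M *ᵥ u = 0) :
    ∃ b : Matrix (Fin n) (Fin n) ℝ,
      b.BlockTriangular id ∧ b.det ≠ 0 ∧ M * b = b * Xmat n k ε := by
  choose v hsupp hdiag hlow hmid using exists_adapted_vector hcorner hker
  let b : Matrix (Fin n) (Fin n) ℝ := fun s t =>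
    if (t.rev : ℕ) < k then antiCoeff k ε t.rev * (M *ᵥ v t.rev) s else v t s
  have hb : b.BlockTriangular id := by
    intro s t hts
    simp only [id] at hts
    by_cases ht : (t.rev : ℕ) < k
    · have hst : s.rev < t.rev := Fin.rev_lt_rev.mpr hts
      have := hlow _ ht s.rev hst.le
      rw [Fin.rev_rev, if_neg hst.ne] at this
      simp only [b, if_pos ht, this, mul_zero]
    · simp only [b, if_neg ht, hsupp t s hts]
  refine ⟨b, hb, ?_, ?_⟩
  · rw [Matrix.det_of_isUpperTriangular hb, Finset.prod_ne_zero_iff]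
    intro t _
    by_cases ht : (t.rev : ℕ) < k
    · have := hlow _ ht t.rev le_rfl
      rw [Fin.rev_rev, if_pos rfl] at this
      simp only [b, if_pos ht, this, mul_one]
      exact antiCoeff_ne_zero hε ht
    · simp only [b, if_neg ht]
      exact hdiag t
  · ext s t
    have hcol : (M * b) s t = (M *ᵥ fun r => b r t) s := rfl
    rw [hcol, mul_Xmat_apply hk hkn]
    have htn := t.2
    by_cases ht : (t.rev : ℕ) < k
    · have htk : k ≤ (t : ℕ) := by rw [Fin.val_rev] at ht; omega
      have hbt : (fun r => b r t) = antiCoeff k ε t.rev • (M *ᵥ v t.rev) := by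
        ext r
        simp only [b, if_pos ht, Pi.smul_apply, smul_eq_mul]
      rw [antiCoeff_eq_zero ε htk, hbt, Matrix.mulVec_smul, Matrix.mulVec_mulVec, hM]
      simp
    · have hbt : (fun r => b r t) = v t := by
        ext r
        simp only [b, if_neg ht]
      rw [hbt]
      rcases lt_or_ge (t : ℕ) k with htk | htk
      · simp only [b, Fin.rev_rev, if_pos htk]
        rw [mul_right_comm, antiCoeff_mul_self hε htk, one_mul]
      · rw [hmid t htk, antiCoeff_eq_zero ε htk]
        simp

/-- For `n = 2k` every invertible matrix in the centralizer of `X_{k,ε}` has positive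
determinant. -/
lemma det_pos_of_commute_Xmat {n k : ℕ} (hk : 2 ≤ k) (hkn : 2 * k = n) {ε : ℝ}
    (hε : ε = 1 ∨ ε = -1) {h : Matrix (Fin n) (Fin n) ℝ} (hdet : h.det ≠ 0)
    (hcomm : h * Xmat n k ε = Xmat n k ε * h) : 0 < h.det := by
  have key : ∀ s t : Fin n, h s.rev t.rev * antiCoeff k ε t = antiCoeff k ε s * h s t := by
    intro s t
    have := congrFun (congrFun hcomm s.rev) t
    rwa [mul_Xmat_apply hk hkn.le, Xmat_mul_apply hk hkn.le, Fin.rev_rev] at this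
  let p : Fin n → Prop := fun i => (i : ℕ) < k
  have hp : ∀ i : Fin n, p i ↔ ¬ p i.rev := fun i => by
    have := i.2
    simp only [p, Fin.val_rev]
    omega
  have hzero : ∀ s, p s → ∀ t, ¬ p t → h s t = 0 := by
    intro s hs t ht
    have := key s t
    rw [antiCoeff_eq_zero ε (not_lt.mp ht), mul_zero] at this
    exact (mul_eq_zero.mp this.symm).resolve_left (antiCoeff_ne_zero hε hs)
  let e : {i // p i} ≃ {i // ¬ p i} := Fin.revPerm.subtypeEquiv hp
  let d : {i // p i} → ℝ := fun i => antiCoeff k ε (i : Fin n)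
  have hconj : (h.toSquareBlockProp fun i => ¬ p i).submatrix e e * Matrix.diagonal d =
      Matrix.diagonal d * h.toSquareBlockProp p := by
    ext s t
    rw [Matrix.mul_diagonal, Matrix.diagonal_mul]
    exact key s t
  have hd : (Matrix.diagonal d).det ≠ 0 := by
    rw [Matrix.det_diagonal, Finset.prod_ne_zero_iff]
    exact fun i _ => antiCoeff_ne_zero hε i.2
  have hblocks : (h.toSquareBlockProp fun i => ¬ p i).det = (h.toSquareBlockProp p).det := by
    have := congrArg Matrix.det hconj
    rw [Matrix.det_mul, Matrix.det_mul, Matrix.det_submatrix_equiv_self, mul_comm] at this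
    exact mul_left_cancel₀ hd this
  rw [Matrix.twoBlockTriangular_det' h p hzero, hblocks] at hdet ⊢
  exact mul_self_pos.mpr (mul_self_ne_zero.mp hdet)

/-- An upper-triangular intertwiner can be normalized to have determinant one. -/
lemma exists_upperTriangular_det_one {n k : ℕ} (hk : 2 ≤ k) (hkn : 2 * k ≤ n) {ε : ℝ}
    (hε : ε = 1 ∨ ε = -1) {M g b : Matrix (Fin n) (Fin n) ℝ} (hg : g.det = 1)
    (hgM : M * g = g * Xmat n k ε) (hb : b.BlockTriangular id) (hdet : b.det ≠ 0)
    (hbM : M * b = b * Xmat n k ε) :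
    ∃ b' : Matrix (Fin n) (Fin n) ℝ,
      b'.BlockTriangular id ∧ b'.det = 1 ∧ M * b' = b' * Xmat n k ε := by
  rcases hkn.lt_or_eq with hlt | heq
  · let j : Fin n := ⟨k, by omega⟩
    let d : Fin n → ℝ := Function.update 1 j b.det⁻¹
    have hcomm : Matrix.diagonal d * Xmat n k ε = Xmat n k ε * Matrix.diagonal d := by
      ext s t
      rw [Matrix.diagonal_mul, Matrix.mul_diagonal, Xmat_apply hk hkn]
      split_ifs with hst
      · rcases lt_or_ge (t : ℕ) k with ht | ht
        · have h1 : s ≠ j := by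
            rw [hst, Ne, Fin.ext_iff, Fin.val_rev]
            simp only [j]
            omega
          have h2 : t ≠ j := by
            rw [Ne, Fin.ext_iff]
            exact ht.ne
          simp [d, h1, h2]
        · simp [antiCoeff_eq_zero ε ht]
      · simp
    refine ⟨b * Matrix.diagonal d, hb.mul (Matrix.blockTriangular_diagonal d), ?_, ?_⟩
    · rw [Matrix.det_mul, Matrix.det_diagonal, Finset.prod_update_of_mem (Finset.mem_univ j)]
      simp [hdet]
    · rw [← Matrix.mul_assoc, hbM, Matrix.mul_assoc, Matrix.mul_assoc, hcomm]
  · have hbu : IsUnit b.det := hdet.isUnit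
    have hbinv : b⁻¹ * M = Xmat n k ε * b⁻¹ := by
      rw [← Matrix.mul_nonsing_inv_cancel_right _ (b⁻¹ * M) hbu, Matrix.mul_assoc b⁻¹, hbM,
        Matrix.nonsing_inv_mul_cancel_left _ _ hbu]
    have hpos : 0 < b.det := by
      have hdet' : (b⁻¹ * g).det = b.det⁻¹ := by
        rw [Matrix.det_mul, hg, mul_one, Matrix.det_nonsing_inv, Ring.inverse_eq_inv']
      have := det_pos_of_commute_Xmat hk heq hε (h := b⁻¹ * g)
        (by rw [hdet']; exact inv_ne_zero hdet)
        (by rw [Matrix.mul_assoc, ← hgM, ← Matrix.mul_assoc, hbinv, Matrix.mul_assoc])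
      rw [hdet'] at this
      exact inv_pos.mp this
    refine ⟨(b.det⁻¹ ^ ((n : ℝ)⁻¹)) • b, fun s t hst => ?_, ?_, ?_⟩
    · rw [Matrix.smul_apply, hb hst, smul_zero]
    · rw [Matrix.det_smul, Fintype.card_fin,
        Real.rpow_inv_natCast_pow (inv_pos.mpr hpos).le (by omega), inv_mul_cancel₀ hdet]
    · rw [Matrix.mul_smul, Matrix.smul_mul, hbM]

lemma coe_inv_eq_nonsing_inv {n : ℕ} (g : Matrix.SpecialLinearGroup (Fin n) ℝ) :
    (g⁻¹).val = g.val⁻¹ := by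
  symm
  apply Matrix.inv_eq_right_inv
  rw [← Matrix.SpecialLinearGroup.coe_mul, mul_inv_cancel, Matrix.SpecialLinearGroup.coe_one]

lemma mem_BOrb_iff_of_mem_Orb {n k : ℕ} (hk : 2 ≤ k) (hkn : 2 * k ≤ n) {ε : ℝ}
    (hε : ε = 1 ∨ ε = -1) {M : Matrix (Fin n) (Fin n) ℝ} (hM : M ∈ Orb n k ε) :
    M ∈ BOrb n k ε ↔ ∀ i ≤ k, (corner i M).det ≠ 0 := by
  constructor
  · rintro ⟨b, hb, rfl⟩ i hi
    rw [coe_inv_eq_nonsing_inv]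
    exact corner_det_ne_zero_of_upperTriangular hk hkn hε (fun s t h => hb s t h)
      (by rw [b.2]; exact isUnit_one) hi
  · intro hcorner
    obtain ⟨g, rfl⟩ := hM
    have hgu : IsUnit g.val.det := by rw [g.2]; exact isUnit_one
    rw [coe_inv_eq_nonsing_inv] at hcorner ⊢
    have hsq : (g.val * Xmat n k ε * g.val⁻¹) * (g.val * Xmat n k ε * g.val⁻¹) = 0 := by
      rw [Matrix.mul_assoc g.val (Xmat n k ε) g.val⁻¹, ← Matrix.mul_assoc,
        Matrix.mul_assoc g.val (_ * _) g.val, Matrix.nonsing_inv_mul_cancel_right _ _ hgu,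
        Matrix.mul_assoc, ← Matrix.mul_assoc (Xmat n k ε), Xmat_mul_self hk hkn]
      simp
    obtain ⟨b, hb, hdet, hbM⟩ := exists_upperTriangular_intertwiner hk hkn hε hsq hcorner
      fun _ hu => conj_mulVec_eq_zero hk hkn (hcorner k le_rfl) hu
    obtain ⟨b', hb', hdet', hbM'⟩ := exists_upperTriangular_det_one hk hkn hε g.2
      (Matrix.nonsing_inv_mul_cancel_right _ _ hgu) hb hdet hbM
    let β : Matrix.SpecialLinearGroup (Fin n) ℝ := ⟨b', hdet'⟩
    refine ⟨β, fun s t h => hb' h, ?_⟩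
    rw [coe_inv_eq_nonsing_inv β]
    change b' * Xmat n k ε * b'⁻¹ = _
    rw [← hbM', Matrix.mul_nonsing_inv_cancel_right _ _ (by rw [hdet']; exact isUnit_one)]

theorem BOrbit_isOpen_in_orbit (n : ℕ) (hn : 4 ≤ n) (k : ℕ) (hk : 2 ≤ k)
    (hkn : 2 * k ≤ n) (ε : ℝ) (hε : ε = 1 ∨ ε = -1) :
    IsOpen {x : ↥(Orb n k ε) | (x : Matrix (Fin n) (Fin n) ℝ) ∈ BOrb n k ε} := by
  have hset : {x : ↥(Orb n k ε) | (x : Matrix (Fin n) (Fin n) ℝ) ∈ BOrb n k ε} =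
      ⋂ i ∈ Set.Iic k, {x : ↥(Orb n k ε) | (corner i x.val).det ≠ 0} := by
    ext x
    simpa using mem_BOrb_iff_of_mem_Orb hk hkn hε x.2
  rw [hset]
  refine (Set.finite_Iic k).isOpen_biInter fun i _ => ?_
  exact isOpen_ne_fun ((continuous_corner i).comp continuous_subtype_val).matrix_det
    continuous_const
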